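/- Let h : ℝ^d → ℝ be α-Hölder for some α ∈ (0,1], and let f_h(x) = −∫₀¹ (1/(2t)) E[ h̄(√t x + √(1−t) Z) ] dt with h̄ = h − E h(Z), Z ~ N(0, I_d). Then for all x, y ∈ ℝ^d: if |x−y| ≤ 1 then ‖∇²f_h(x) − ∇²f_h(y)‖_op ≤ [h]_α |x−y|^α (C₁(α,d) − 2 log|x−y|), and if |x−y| > 1 then ‖∇²f_h(x) − ∇²f_h(y)‖_op ≤ C₁(α,d) [h]_α, where C₁(α,d) = 2^{α/2+1} ((α+2d)/(αd)) Γ((α+d)/2)/Γ(d/2). -/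

import Mathlib

open MeasureTheory ProbabilityTheory Real Filter Set

noncomputable section

/-- The standard Gaussian measure `N(0, I_d)` on `ℝ^d` (as `EuclideanSpace ℝ (Fin d)`). -/
def stdGaussian (d : ℕ) : Measure (EuclideanSpace ℝ (Fin d)) :=
  (Measure.pi fun _ : Fin d => gaussianReal 0 1).map
    ⇑(EuclideanSpace.equiv (Fin d) ℝ).symm

/-- Partial derivative in the `j`-th coordinate direction. -/
def pderivI {d : ℕ} (j : Fin d) (f : EuclideanSpace ℝ (Fin d) → ℝ) :
    EuclideanSpace ℝ (Fin d) → ℝ :=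
  fun x => fderiv ℝ f x (EuclideanSpace.single j 1)

/-- Iterated partial derivative along a list of coordinate directions (head applied last,
i.e. outermost). -/
def pderivList {d : ℕ} : List (Fin d) → (EuclideanSpace ℝ (Fin d) → ℝ) →
    EuclideanSpace ℝ (Fin d) → ℝ
  | [], f => f
  | j :: l, f => pderivI j (pderivList l f)

/-- Multi-index partial derivative `∂^{|m|}/(∂x₁^{m₁} ⋯ ∂x_d^{m_d})`. -/
def pderivMulti {d : ℕ} (m : Fin d → ℕ) (f : EuclideanSpace ℝ (Fin d) → ℝ) :
    EuclideanSpace ℝ (Fin d) → ℝ :=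
  pderivList ((List.finRange d).flatMap fun j => List.replicate (m j) j) f

/-- Multivariate Hermite polynomial
`H_m(x) = (-1)^{|m|} e^{|x|²/2} ∂^{|m|}/(∂x₁^{m₁} ⋯ ∂x_d^{m_d}) e^{-|x|²/2}`. -/
def hermiteMulti {d : ℕ} (m : Fin d → ℕ) (x : EuclideanSpace ℝ (Fin d)) : ℝ :=
  (-1 : ℝ) ^ (∑ j, m j) * Real.exp (‖x‖ ^ 2 / 2) *
    pderivMulti m (fun y => Real.exp (-‖y‖ ^ 2 / 2)) x

/-- `h̄ = h - E h(Z)` with `Z ~ N(0, I_d)`. -/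
def hbar (d : ℕ) (h : EuclideanSpace ℝ (Fin d) → ℝ) (x : EuclideanSpace ℝ (Fin d)) : ℝ :=
  h x - ∫ z, h z ∂(stdGaussian d)

/-- Barbour's solution `f_h(x) = -∫₀¹ (1/(2t)) E[ h̄(√t x + √(1-t) Z) ] dt` of the
multivariate Stein equation. -/
def steinSol (d : ℕ) (h : EuclideanSpace ℝ (Fin d) → ℝ) (x : EuclideanSpace ℝ (Fin d)) : ℝ :=
  -∫ t in Ioo (0 : ℝ) 1,
      (1 / (2 * t)) *
        ∫ z, hbar d h (Real.sqrt t • x + Real.sqrt (1 - t) • z) ∂(stdGaussian d)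

/-- Entry `(i, j)` of the Hessian matrix of `f` at `x`. -/
def hessEntry {d : ℕ} (f : EuclideanSpace ℝ (Fin d) → ℝ) (x : EuclideanSpace ℝ (Fin d))
    (i j : Fin d) : ℝ :=
  pderivI i (pderivI j f) x

/-- The Hessian matrix `∇² f(x)`. -/
def hessMatrix {d : ℕ} (f : EuclideanSpace ℝ (Fin d) → ℝ) (x : EuclideanSpace ℝ (Fin d)) :
    Matrix (Fin d) (Fin d) ℝ :=
  Matrix.of fun i j => hessEntry f x i j

/-- Operator norm `‖M‖_op = sup_{|v| = 1} |M v|` (Euclidean norms) of a `d × d` matrix. -/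
def matOpNorm {d : ℕ} (M : Matrix (Fin d) (Fin d) ℝ) : ℝ :=
  sSup { r | ∃ v : EuclideanSpace ℝ (Fin d), ‖v‖ = 1 ∧
    r = ‖(WithLp.equiv 2 (Fin d → ℝ)).symm (M.mulVec ((WithLp.equiv 2 (Fin d → ℝ)) v))‖ }

/-- The Laplacian `Δ f(x) = ∑ i ∂²f/∂x_i²(x)`. -/
def laplacian {d : ℕ} (f : EuclideanSpace ℝ (Fin d) → ℝ) (x : EuclideanSpace ℝ (Fin d)) : ℝ :=
  ∑ i, hessEntry f x i i

/-- `C` is an `α`-Hölder constant for `h`. -/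
def HolderConst {d : ℕ} (α C : ℝ) (h : EuclideanSpace ℝ (Fin d) → ℝ) : Prop :=
  ∀ x y, |h x - h y| ≤ C * dist x y ^ α

/-- The 1-Wasserstein distance in dual form: sup over 1-Lipschitz test functions. -/
def wasserstein1 {d : ℕ} (μ ν : Measure (EuclideanSpace ℝ (Fin d))) : ℝ :=
  sSup { r | ∃ h : EuclideanSpace ℝ (Fin d) → ℝ, LipschitzWith 1 h ∧
    r = (∫ x, h x ∂μ) - ∫ x, h x ∂ν }

/-- The `α`-Wasserstein distance: sup over continuous `h` with `[h]_α ≤ 1`. -/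
def wassersteinHolder {d : ℕ} (α : ℝ) (μ ν : Measure (EuclideanSpace ℝ (Fin d))) : ℝ :=
  sSup { r | ∃ h : EuclideanSpace ℝ (Fin d) → ℝ, Continuous h ∧ HolderConst α 1 h ∧
    r = (∫ x, h x ∂μ) - ∫ x, h x ∂ν }

/-- The constant `C₁(α, d)`. -/
def C1 (α : ℝ) (d : ℕ) : ℝ :=
  2 ^ (α / 2 + 1) * ((α + 2 * d) / (α * d)) * Real.Gamma ((α + d) / 2) / Real.Gamma (d / 2)

/-- The constant `C₂(α, d)`. -/
def C2 (α : ℝ) (d : ℕ) : ℝ :=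
  if α = 1 then 2 * Real.sqrt (2 / π) * Real.sqrt d
  else 2 ^ (α / 2 + 1) * (α + 2 * d) * Real.Gamma ((α + d) / 2) / (α * Real.Gamma (d / 2))

end

section

open Topology RealInnerProductSpace Module

section GaussianDensity

variable {E : Type*} [NormedAddCommGroup E] [InnerProductSpace ℝ E]

variable (E) in
/-- The density of the standard Gaussian measure with respect to Lebesgue measure. -/
noncomputable def stdGaussianDensity (w : E) : ℝ :=
  (2 * π) ^ (-(finrank ℝ E : ℝ) / 2) * Real.exp (-(1 / 2) * ‖w‖ ^ 2)

lemma stdGaussianDensity_pos (w : E) : 0 < stdGaussianDensity E w := by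
  unfold stdGaussianDensity
  positivity

lemma continuous_stdGaussianDensity : Continuous (stdGaussianDensity E) := by
  unfold stdGaussianDensity
  fun_prop

lemma hasFDerivAt_stdGaussianDensity (w : E) :
    HasFDerivAt (stdGaussianDensity E) (innerSL ℝ (-stdGaussianDensity E w • w)) w := by
  unfold stdGaussianDensity
  have h := (((hasStrictFDerivAt_norm_sq w).hasFDerivAt.const_mul (-(1 / 2 : ℝ))).exp).const_mul
    ((2 * π) ^ (-(finrank ℝ E : ℝ) / 2))
  refine h.congr_fderiv ?_
  ext u
  simp
  ring

variable [FiniteDimensional ℝ E] [MeasurableSpace E] [BorelSpace E]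

lemma stdGaussian_eq_withDensity :
    ProbabilityTheory.stdGaussian E =
      (volume : Measure E).withDensity fun w ↦ ENNReal.ofReal (stdGaussianDensity E w) := by
  have hint : Integrable (stdGaussianDensity E) := by
    have h := GaussianFourier.integrable_cexp_neg_mul_sq_norm_add (V := E) (b := 1 / 2)
      (by norm_num) 0 0
    refine (h.norm.const_mul ((2 * π) ^ (-(finrank ℝ E : ℝ) / 2))).congr (ae_of_all _ fun w ↦ ?_)
    simp only [Complex.norm_exp, stdGaussianDensity]
    congr 2
    simp [← Complex.ofReal_pow]
  have : IsFiniteMeasure ((volume : Measure E).withDensity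
      fun w ↦ ENNReal.ofReal (stdGaussianDensity E w)) :=
    isFiniteMeasure_withDensity_ofReal hint.2
  apply Measure.ext_of_charFun
  ext t
  rw [charFun_stdGaussian, charFun_apply, integral_withDensity_eq_integral_toReal_smul
    (continuous_stdGaussianDensity.measurable.ennreal_ofReal) (ae_of_all _ fun _ ↦ by simp)]
  have h := GaussianFourier.integral_cexp_neg_mul_sq_norm_add (V := E) (b := 1 / 2)
      (by norm_num) Complex.I t
  have h2 : ∀ w : E, (ENNReal.ofReal (stdGaussianDensity E w)).toReal •
      Complex.exp (⟪w, t⟫ * Complex.I) = (((2 * π) ^ (-(finrank ℝ E : ℝ) / 2) : ℝ) : ℂ) *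
        Complex.exp (-(1 / 2) * ‖w‖ ^ 2 + Complex.I * ⟪t, w⟫) := by
    intro w
    rw [ENNReal.toReal_ofReal (stdGaussianDensity_pos w).le, stdGaussianDensity, Complex.exp_add,
      Complex.real_smul, real_inner_comm t w]
    push_cast
    rw [mul_comm Complex.I]
    ring
  simp_rw [h2]
  rw [integral_const_mul, h]
  have h3 : ((π : ℂ) / (1 / 2)) ^ (finrank ℝ E / 2 : ℂ) =
      (((2 * π) ^ ((finrank ℝ E : ℝ) / 2) : ℝ) : ℂ) := by
    rw [Complex.ofReal_cpow (by positivity)]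
    push_cast
    congr 1
    ring
  rw [h3, ← mul_assoc, ← Complex.ofReal_mul, ← Real.rpow_add (by positivity),
    show -(finrank ℝ E : ℝ) / 2 + finrank ℝ E / 2 = 0 by ring]
  simp
  ring_nf

lemma integral_stdGaussian {F : Type*} [NormedAddCommGroup F] [NormedSpace ℝ F] (f : E → F) :
    ∫ w, f w ∂(ProbabilityTheory.stdGaussian E) = ∫ w, stdGaussianDensity E w • f w := by
  rw [stdGaussian_eq_withDensity, integral_withDensity_eq_integral_toReal_smul
    (continuous_stdGaussianDensity.measurable.ennreal_ofReal) (ae_of_all _ fun _ ↦ by simp)]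
  simp_rw [ENNReal.toReal_ofReal (stdGaussianDensity_pos _).le]

/-- Absolute moments of the standard Gaussian measure. -/
lemma integral_norm_rpow_stdGaussian [Nontrivial E] {p : ℝ} (hp : 0 ≤ p) :
    ∫ w, ‖w‖ ^ p ∂(ProbabilityTheory.stdGaussian E) =
      2 ^ (p / 2) * Real.Gamma ((p + finrank ℝ E) / 2) / Real.Gamma (finrank ℝ E / 2) := by
  have hn : 0 < (finrank ℝ E : ℝ) := by exact_mod_cast finrank_pos
  obtain ⟨K, hK⟩ : ∃ K : ℝ, ∀ q : ℝ, 0 ≤ q → ∫ w, ‖w‖ ^ q ∂(ProbabilityTheory.stdGaussian E) =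
      K * (2 ^ (q / 2) * Real.Gamma ((q + finrank ℝ E) / 2)) := by
    refine ⟨finrank ℝ E * (volume : Measure E).real (Metric.ball 0 1) *
      ((2 * π) ^ (-(finrank ℝ E : ℝ) / 2) * (2 ^ ((finrank ℝ E : ℝ) / 2) * (1 / 2))), fun q hq ↦ ?_⟩
    rw [integral_stdGaussian]
    have h := integral_fun_norm_addHaar (volume : Measure E) fun y ↦
      ((2 * π) ^ (-(finrank ℝ E : ℝ) / 2) * Real.exp (-(1 / 2) * y ^ 2)) • y ^ q
    simp only [stdGaussianDensity]
    rw [h]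
    have h2 : ∫ y in Ioi (0 : ℝ), y ^ (finrank ℝ E - 1) •
        (((2 * π) ^ (-(finrank ℝ E : ℝ) / 2) * Real.exp (-(1 / 2) * y ^ 2)) • y ^ q) =
        ∫ y in Ioi (0 : ℝ), (2 * π) ^ (-(finrank ℝ E : ℝ) / 2) *
          (y ^ (finrank ℝ E - 1 + q) * Real.exp (-(1 / 2) * y ^ (2 : ℝ))) := by
      refine setIntegral_congr_fun measurableSet_Ioi fun y hy ↦ ?_
      have hy : 0 < y := hy
      simp only [smul_eq_mul]
      rw [Real.rpow_add hy, ← Real.rpow_natCast y (finrank ℝ E - 1), Nat.cast_sub finrank_pos,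
        Real.rpow_two]
      push_cast
      ring
    rw [h2, integral_const_mul, integral_rpow_mul_exp_neg_mul_rpow two_pos (by linarith)
      (by norm_num), one_div, Real.inv_rpow two_pos.le, ← Real.rpow_neg two_pos.le]
    have h3 : (2 : ℝ) ^ (-(-((finrank ℝ E : ℝ) - 1 + q + 1) / 2)) =
        2 ^ ((finrank ℝ E : ℝ) / 2) * 2 ^ (q / 2) := by
      rw [← Real.rpow_add two_pos]; ring_nf
    have h4 : ((finrank ℝ E : ℝ) - 1 + q + 1) / 2 = (q + finrank ℝ E) / 2 := by ring
    rw [h3, h4, nsmul_eq_mul, smul_eq_mul]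
    ring
  have h0 := hK 0 le_rfl
  have hG : 0 < Real.Gamma ((finrank ℝ E : ℝ) / 2) := Real.Gamma_pos_of_pos (by positivity)
  simp only [Real.rpow_zero, integral_const, probReal_univ, zero_div, zero_add, one_mul,
    smul_eq_mul] at h0
  rw [hK p hp, eq_div_iff hG.ne']
  linear_combination -(2 ^ (p / 2) * Real.Gamma ((p + finrank ℝ E) / 2)) * h0

lemma integrable_norm_rpow_stdGaussian {p : ℝ} (hp : 0 ≤ p) :
    Integrable (fun w ↦ ‖w‖ ^ p) (ProbabilityTheory.stdGaussian E) := by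
  rcases hp.eq_or_lt with rfl | hp
  · simp
  have h := (IsGaussian.memLp_id (ProbabilityTheory.stdGaussian E) (ENNReal.ofReal p)
    (by simp)).integrable_norm_rpow (by simpa using hp) (by simp)
  simpa [ENNReal.toReal_ofReal hp.le] using h

/-- By rotation invariance, each direction contributes equally to the moments. -/
lemma integral_norm_rpow_mul_inner_sq_stdGaussian [Nontrivial E] {p : ℝ} (hp : 0 ≤ p) {u : E}
    (hu : ‖u‖ = 1) :
    ∫ w, ‖w‖ ^ p * ⟪w, u⟫ ^ 2 ∂(ProbabilityTheory.stdGaussian E) =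
      (p + finrank ℝ E) / finrank ℝ E * ∫ w, ‖w‖ ^ p ∂(ProbabilityTheory.stdGaussian E) := by
  have hn : 0 < (finrank ℝ E : ℝ) := by exact_mod_cast finrank_pos
  let b := stdOrthonormalBasis ℝ E
  have hrot : ∀ i, ∫ w, ‖w‖ ^ p * ⟪w, b i⟫ ^ 2 ∂(ProbabilityTheory.stdGaussian E) =
      ∫ w, ‖w‖ ^ p * ⟪w, u⟫ ^ 2 ∂(ProbabilityTheory.stdGaussian E) := by
    intro i
    let R : E ≃ₗᵢ[ℝ] E := (ℝ ∙ (u - b i))ᗮ.reflection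
    have hR : R u = b i := Submodule.reflection_sub (by simp [hu])
    conv_lhs => rw [← stdGaussian_map R]
    rw [integral_map R.continuous.aemeasurable]
    · simp [← hR]
    · refine Continuous.aestronglyMeasurable ?_
      exact (continuous_norm.rpow_const fun _ ↦ .inr hp).mul (by fun_prop)
  have hi : ∀ i, Integrable (fun w ↦ ‖w‖ ^ p * ⟪w, b i⟫ ^ 2)
      (ProbabilityTheory.stdGaussian E) := by
    intro i
    refine (integrable_norm_rpow_stdGaussian (E := E) (p := p + 2) (by positivity)).mono'
      (Continuous.aestronglyMeasurable
        ((continuous_norm.rpow_const fun _ ↦ .inr hp).mul (by fun_prop)))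
      (ae_of_all _ fun w ↦ ?_)
    rw [Real.rpow_add_of_nonneg (norm_nonneg _) hp two_pos.le, Real.rpow_two, norm_mul, norm_pow,
      Real.norm_of_nonneg (by positivity)]
    gcongr
    simpa using norm_inner_le_norm (𝕜 := ℝ) w (b i)
  have hsum : (finrank ℝ E : ℝ) * ∫ w, ‖w‖ ^ p * ⟪w, u⟫ ^ 2 ∂(ProbabilityTheory.stdGaussian E) =
      ∫ w, ‖w‖ ^ (p + 2) ∂(ProbabilityTheory.stdGaussian E) := by
    have : ∑ i, ∫ w, ‖w‖ ^ p * ⟪w, b i⟫ ^ 2 ∂(ProbabilityTheory.stdGaussian E) =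
        ∫ w, ‖w‖ ^ (p + 2) ∂(ProbabilityTheory.stdGaussian E) := by
      rw [← integral_finsetSum _ fun i _ ↦ hi i]
      refine integral_congr_ae (ae_of_all _ fun w ↦ ?_)
      simp only
      rw [← Finset.mul_sum, b.sum_sq_inner_left, Real.rpow_add_of_nonneg (norm_nonneg _) hp
        two_pos.le, Real.rpow_two]
    rw [← this]
    simp [hrot]
  rw [integral_norm_rpow_stdGaussian (by positivity)] at hsum
  rw [integral_norm_rpow_stdGaussian hp]
  have h1 : (p + 2 + finrank ℝ E) / 2 = (p + finrank ℝ E) / 2 + 1 := by ring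
  have h2 : (p + 2) / 2 = p / 2 + 1 := by ring
  rw [h1, h2, Real.Gamma_add_one (by positivity), Real.rpow_add two_pos, Real.rpow_one] at hsum
  rw [← mul_right_inj' hn.ne', hsum]
  field_simp

end GaussianDensity

section GaussianSmoothing

variable {E : Type*} [NormedAddCommGroup E] [InnerProductSpace ℝ E]

lemma exists_stdGaussianDensity_mul_le (m : ℕ) :
    ∃ K, ∀ w : E, stdGaussianDensity E w * (1 + ‖w‖) ^ m ≤
      K * (1 + ‖w‖) ^ (-(finrank ℝ E + 2 : ℝ)) := by
  refine ⟨(2 * π) ^ (-(finrank ℝ E : ℝ) / 2) * ((m + (finrank ℝ E + 2)).factorial *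
    Real.exp (3 / 2)), fun w ↦ ?_⟩
  have h1 := Real.pow_div_factorial_le_exp (1 + ‖w‖) (by positivity) (m + (finrank ℝ E + 2))
  rw [div_le_iff₀ (by positivity)] at h1
  have h2 : Real.exp (-(1 / 2) * ‖w‖ ^ 2) * Real.exp (1 + ‖w‖) ≤ Real.exp (3 / 2) := by
    rw [← Real.exp_add]
    gcongr
    nlinarith [sq_nonneg (‖w‖ - 1)]
  have h3 : (1 + ‖w‖) ^ (-(finrank ℝ E + 2 : ℝ)) = ((1 + ‖w‖) ^ (finrank ℝ E + 2))⁻¹ := by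
    rw [Real.rpow_neg (by positivity)]
    norm_cast
  rw [h3, ← div_eq_mul_inv, le_div_iff₀ (by positivity), mul_assoc, ← pow_add, stdGaussianDensity,
    mul_assoc]
  refine mul_le_mul_of_nonneg_left ?_ (by positivity)
  calc _ ≤ Real.exp (-(1 / 2) * ‖w‖ ^ 2) *
        (Real.exp (1 + ‖w‖) * (m + (finrank ℝ E + 2)).factorial) := by gcongr
    _ = (m + (finrank ℝ E + 2)).factorial *
        (Real.exp (-(1 / 2) * ‖w‖ ^ 2) * Real.exp (1 + ‖w‖)) := by ring
    _ ≤ _ := by gcongr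

variable {h : E → ℝ} {A : ℝ}

lemma hasFDerivAt_comp_smul {G : E → ℝ} {s : ℝ} {F : E → ℝ} {x w : E}
    (hG : HasFDerivAt G (innerSL ℝ w) (s • x)) (hF : ∀ x, F x = G (s • x)) :
    HasFDerivAt F (innerSL ℝ (s • w)) x := by
  rw [funext hF]
  refine (hG.comp x ((hasFDerivAt_id x).const_smul s)).congr_fderiv ?_
  ext u
  simp

lemma smul_add_smul_eq_smul_add {t : ℝ} (ht : t < 1) (x z : E) :
    √t • x + √(1 - t) • z = √(1 - t) • (z + (√t / √(1 - t)) • x) := by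
  have : 0 < √(1 - t) := Real.sqrt_pos.2 (by linarith)
  rw [smul_add, smul_smul, mul_div_cancel₀ _ this.ne', add_comm]

lemma abs_comp_sqrt_smul_le (hA : ∀ w, |h w| ≤ A * (1 + ‖w‖)) {t : ℝ} (ht : 0 ≤ t) (w : E) :
    |h (√(1 - t) • w)| ≤ A * (1 + ‖w‖) := by
  have hA0 : 0 ≤ A := by simpa using (abs_nonneg _).trans (hA 0)
  have h1 : √(1 - t) ≤ 1 := Real.sqrt_le_one.2 (by linarith)
  refine (hA _).trans ?_
  rw [norm_smul, Real.norm_of_nonneg (Real.sqrt_nonneg _)]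
  gcongr
  exact mul_le_of_le_one_left (norm_nonneg w) h1

variable [FiniteDimensional ℝ E] [MeasurableSpace E] [BorelSpace E]

/-- Differentiation under the integral sign for `a ↦ ∫ ψ z * k (z + a)`, where the derivative
falls on the rapidly decreasing factor `ψ`. -/
lemma hasFDerivAt_integral_mul_comp_add {ψ : E → ℝ} {ψ' : E → E} {k : E → ℝ} {K : ℝ}
    (hψ : ∀ w, HasFDerivAt ψ (innerSL ℝ (ψ' w)) w) (hψ' : Continuous ψ')
    (hb : ∀ w, ‖ψ w‖ ≤ K * (1 + ‖w‖) ^ (-(finrank ℝ E + 2 : ℝ)))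
    (hb' : ∀ w, ‖ψ' w‖ ≤ K * (1 + ‖w‖) ^ (-(finrank ℝ E + 2 : ℝ)))
    (hk : Continuous k) (hkA : ∀ w, |k w| ≤ A * (1 + ‖w‖)) (a : E) :
    HasFDerivAt (fun a ↦ ∫ z, ψ z * k (z + a)) (innerSL ℝ (-∫ z, k (z + a) • ψ' z)) a := by
  have hK : 0 ≤ K := by simpa using (norm_nonneg _).trans (hb 0)
  have hA : 0 ≤ A := by simpa using (abs_nonneg _).trans (hkA 0)
  have hψc : Continuous ψ := continuous_iff_continuousAt.2 fun w ↦ (hψ w).continuousAt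
  have htrans : ∀ a : E, ∫ z, ψ z * k (z + a) = ∫ w, ψ (w - a) * k w := fun a ↦ by
    simpa using integral_add_right_eq_self (μ := (volume : Measure E)) (fun w ↦ ψ (w - a) * k w) a
  have htrans' : ∫ z, k (z + a) • ψ' z = ∫ w, k w • ψ' (w - a) := by
    simpa using integral_add_right_eq_self (μ := (volume : Measure E)) (fun w ↦ k w • ψ' (w - a)) a
  simp_rw [htrans, htrans']
  have hdecay : ∀ w, ∀ x ∈ Metric.ball a 1, ∀ r : ℝ,
      r ≤ K * (1 + ‖w - x‖) ^ (-(finrank ℝ E + 2 : ℝ)) →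
      r * |k w| ≤ (K * 2 ^ (finrank ℝ E + 2 : ℝ) * (A * (1 + ‖a‖))) *
        (1 + ‖w - a‖) ^ (-(finrank ℝ E + 1 : ℝ)) := by
    intro w x hx r hr
    have hxa : ‖x - a‖ ≤ 1 := by simpa [dist_eq_norm] using (Metric.mem_ball.1 hx).le
    have h1 : (1 + ‖w - a‖) / 2 ≤ 1 + ‖w - x‖ := by
      have : ‖w - a‖ ≤ ‖w - x‖ + ‖x - a‖ := by simpa using norm_add_le (w - x) (x - a)
      linarith [norm_nonneg (w - x)]
    have h2 : 1 + ‖w‖ ≤ (1 + ‖a‖) * (1 + ‖w - a‖) := by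
      have : ‖w‖ ≤ ‖w - a‖ + ‖a‖ := by simpa using norm_add_le (w - a) a
      nlinarith [norm_nonneg a, norm_nonneg (w - a)]
    have h3 : (1 + ‖w - x‖) ^ (-(finrank ℝ E + 2 : ℝ)) ≤
        2 ^ (finrank ℝ E + 2 : ℝ) * (1 + ‖w - a‖) ^ (-(finrank ℝ E + 2 : ℝ)) := by
      refine (Real.rpow_le_rpow_of_nonpos (by positivity) h1
        (by linarith [(finrank ℝ E).cast_nonneg (α := ℝ)])).trans_eq ?_
      rw [Real.div_rpow (by positivity) two_pos.le, Real.rpow_neg two_pos.le, div_inv_eq_mul,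
        mul_comm]
    have h4 : (1 + ‖w - a‖) ^ (-(finrank ℝ E + 2 : ℝ)) * (1 + ‖w - a‖) =
        (1 + ‖w - a‖) ^ (-(finrank ℝ E + 1 : ℝ)) := by
      rw [← Real.rpow_add_one (by positivity)]
      ring_nf
    calc r * |k w| ≤ (K * (2 ^ (finrank ℝ E + 2 : ℝ) *
            (1 + ‖w - a‖) ^ (-(finrank ℝ E + 2 : ℝ)))) * (A * ((1 + ‖a‖) * (1 + ‖w - a‖))) := by
          refine mul_le_mul (hr.trans (by gcongr)) ((hkA w).trans (by gcongr)) (abs_nonneg _)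
            (by positivity)
      _ = _ := by rw [← h4]; ring
  have hbound : Integrable (fun w : E ↦ (K * 2 ^ (finrank ℝ E + 2 : ℝ) * (A * (1 + ‖a‖))) *
        (1 + ‖w - a‖) ^ (-(finrank ℝ E + 1 : ℝ))) := by
    refine Integrable.const_mul ?_ _
    exact (integrable_one_add_norm (μ := (volume : Measure E))
      (r := finrank ℝ E + 1) (by linarith)).comp_sub_right a
  have hF' : ∫ w, -(k w • innerSL ℝ (ψ' (w - a))) = innerSL ℝ (-∫ w, k w • ψ' (w - a)) := by
    have : Integrable (fun w ↦ k w • ψ' (w - a)) := by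
      refine hbound.mono' (by fun_prop) (ae_of_all _ fun w ↦ ?_)
      rw [norm_smul, mul_comm, Real.norm_eq_abs]
      exact hdecay w a (Metric.mem_ball_self one_pos) _ (hb' _)
    rw [map_neg, ← (innerSL ℝ).integral_comp_comm this, integral_neg]
    simp
  rw [← hF']
  refine hasFDerivAt_integral_of_dominated_of_fderiv_le (μ := (volume : Measure E))
    (F' := fun x w ↦ -(k w • innerSL ℝ (ψ' (w - x))))
    (Metric.ball_mem_nhds a one_pos) (Eventually.of_forall fun x ↦ ?_) ?_ ?_
    (ae_of_all _ fun w x hx ↦ ?_) hbound (ae_of_all _ fun w x _ ↦ ?_)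
  · exact Continuous.aestronglyMeasurable (by fun_prop)
  · refine hbound.mono' (Continuous.aestronglyMeasurable (by fun_prop)) (ae_of_all _ fun w ↦ ?_)
    rw [norm_mul, Real.norm_eq_abs (k w)]
    exact hdecay w a (Metric.mem_ball_self one_pos) _ (hb _)
  · exact Continuous.aestronglyMeasurable (by fun_prop)
  · rw [norm_neg, norm_smul, innerSL_apply_norm, mul_comm, Real.norm_eq_abs]
    exact hdecay w x hx _ (hb' _)
  · have h1 := (hψ (w - x)).comp x ((hasFDerivAt_id x).const_sub w)
    refine (h1.mul_const (k w)).congr_fderiv ?_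
    ext u
    simp

variable {k : E → ℝ}

lemma hasFDerivAt_integral_comp_add_stdGaussian (hk : Continuous k)
    (hkA : ∀ w, |k w| ≤ A * (1 + ‖w‖)) (a : E) :
    HasFDerivAt (fun a ↦ ∫ z, k (z + a) ∂(ProbabilityTheory.stdGaussian E))
      (innerSL ℝ (∫ z, k (z + a) • z ∂(ProbabilityTheory.stdGaussian E))) a := by
  obtain ⟨K, hK⟩ := exists_stdGaussianDensity_mul_le (E := E) 1
  have hb : ∀ w : E, ∀ r : ℝ, r ≤ 1 + ‖w‖ → stdGaussianDensity E w * r ≤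
      K * (1 + ‖w‖) ^ (-(finrank ℝ E + 2 : ℝ)) := fun w r hr ↦
    (mul_le_mul_of_nonneg_left (by simpa using hr) (stdGaussianDensity_pos w).le).trans (hK w)
  have h := hasFDerivAt_integral_mul_comp_add (K := K) hasFDerivAt_stdGaussianDensity
    (continuous_stdGaussianDensity.neg.smul continuous_id)
    (fun w ↦ by
      simpa [Real.norm_of_nonneg (stdGaussianDensity_pos w).le] using
        hb w 1 (by linarith [norm_nonneg w]))
    (fun w ↦ by
      rw [norm_smul, norm_neg, Real.norm_of_nonneg (stdGaussianDensity_pos w).le]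
      exact hb w _ (by linarith)) hk hkA a
  simp_rw [integral_stdGaussian, smul_eq_mul]
  refine h.congr_fderiv ?_
  rw [← integral_neg]
  congr 2
  ext1 z
  module

lemma hasFDerivAt_integral_inner_mul_comp_add_stdGaussian (hk : Continuous k)
    (hkA : ∀ w, |k w| ≤ A * (1 + ‖w‖)) (v a : E) :
    HasFDerivAt (fun a ↦ ∫ z, ⟪z, v⟫ * k (z + a) ∂(ProbabilityTheory.stdGaussian E))
      (innerSL ℝ (∫ z, k (z + a) • (⟪z, v⟫ • z - v) ∂(ProbabilityTheory.stdGaussian E))) a := by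
  obtain ⟨K, hK⟩ := exists_stdGaussianDensity_mul_le (E := E) 2
  have hb : ∀ w : E, ∀ r : ℝ, r ≤ ‖v‖ * (1 + ‖w‖) ^ 2 → stdGaussianDensity E w * r ≤
      (‖v‖ * K) * (1 + ‖w‖) ^ (-(finrank ℝ E + 2 : ℝ)) := fun w r hr ↦
    calc _ ≤ stdGaussianDensity E w * (‖v‖ * (1 + ‖w‖) ^ 2) :=
          mul_le_mul_of_nonneg_left hr (stdGaussianDensity_pos w).le
      _ = ‖v‖ * (stdGaussianDensity E w * (1 + ‖w‖) ^ 2) := by ring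
      _ ≤ ‖v‖ * (K * (1 + ‖w‖) ^ (-(finrank ℝ E + 2 : ℝ))) := mul_le_mul_of_nonneg_left (hK w) (norm_nonneg v)
      _ = _ := by ring
  have hin : ∀ w : E, |⟪w, v⟫| ≤ ‖w‖ * ‖v‖ := fun w ↦ abs_real_inner_le_norm w v
  have h := hasFDerivAt_integral_mul_comp_add (K := ‖v‖ * K)
    (ψ := fun w ↦ stdGaussianDensity E w * ⟪w, v⟫)
    (ψ' := fun w ↦ stdGaussianDensity E w • (v - ⟪w, v⟫ • w))
    (fun w ↦ by
      have h2 : HasFDerivAt (fun w : E ↦ ⟪w, v⟫) (innerSL ℝ v) w := by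
        simp_rw [real_inner_comm v]
        exact (innerSL ℝ v).hasFDerivAt
      refine ((hasFDerivAt_stdGaussianDensity w).fun_mul h2).congr_fderiv ?_
      ext u
      simp
      ring)
    (continuous_stdGaussianDensity.smul (by fun_prop))
    (fun w ↦ by
      rw [norm_mul, Real.norm_of_nonneg (stdGaussianDensity_pos w).le]
      refine hb w _ ((hin w).trans ?_)
      nlinarith [norm_nonneg v, norm_nonneg w, mul_nonneg (norm_nonneg v) (norm_nonneg w),
        mul_nonneg (norm_nonneg v) (sq_nonneg ‖w‖)])
    (fun w ↦ by
      rw [norm_smul, Real.norm_of_nonneg (stdGaussianDensity_pos w).le]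
      refine hb w _ ((norm_sub_le _ _).trans ?_)
      rw [norm_smul, Real.norm_eq_abs]
      nlinarith [mul_le_mul_of_nonneg_right (hin w) (norm_nonneg w), norm_nonneg v,
        norm_nonneg w, mul_nonneg (norm_nonneg v) (norm_nonneg w)]) hk hkA a
  simp_rw [integral_stdGaussian, smul_eq_mul, ← mul_assoc]
  refine h.congr_fderiv ?_
  rw [← integral_neg]
  congr 2
  ext1 z
  module

lemma hasFDerivAt_integral_smul_add_smul_stdGaussian (hh : Continuous h)
    (hA : ∀ w, |h w| ≤ A * (1 + ‖w‖)) {t : ℝ} (ht : t ∈ Ioo (0 : ℝ) 1) (x : E) :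
    HasFDerivAt (fun x ↦ ∫ z, h (√t • x + √(1 - t) • z) ∂(ProbabilityTheory.stdGaussian E))
      (innerSL ℝ ((√t / √(1 - t)) • ∫ z, h (√t • x + √(1 - t) • z) • z
        ∂(ProbabilityTheory.stdGaussian E))) x := by
  simp_rw [smul_add_smul_eq_smul_add ht.2]
  exact hasFDerivAt_comp_smul (hasFDerivAt_integral_comp_add_stdGaussian
    (k := fun w ↦ h (√(1 - t) • w)) (by fun_prop) (abs_comp_sqrt_smul_le hA ht.1.le) _)
    fun _ ↦ rfl

lemma hasFDerivAt_integral_inner_mul_smul_add_smul_stdGaussian (hh : Continuous h)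
    (hA : ∀ w, |h w| ≤ A * (1 + ‖w‖)) {t : ℝ} (ht : t ∈ Ioo (0 : ℝ) 1) (v x : E) :
    HasFDerivAt (fun x ↦ ∫ z, ⟪z, v⟫ * h (√t • x + √(1 - t) • z)
        ∂(ProbabilityTheory.stdGaussian E))
      (innerSL ℝ ((√t / √(1 - t)) • ∫ z, h (√t • x + √(1 - t) • z) • (⟪z, v⟫ • z - v)
        ∂(ProbabilityTheory.stdGaussian E))) x := by
  simp_rw [smul_add_smul_eq_smul_add ht.2]
  exact hasFDerivAt_comp_smul (hasFDerivAt_integral_inner_mul_comp_add_stdGaussian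
    (k := fun w ↦ h (√(1 - t) • w)) (by fun_prop) (abs_comp_sqrt_smul_le hA ht.1.le) v _)
    fun _ ↦ rfl

end GaussianSmoothing

lemma one_le_sqrt_add_sqrt_one_sub {t : ℝ} (ht : t ∈ Icc (0 : ℝ) 1) : 1 ≤ √t + √(1 - t) := by
  have h1 := Real.sq_sqrt ht.1
  have h2 := Real.sq_sqrt (sub_nonneg.2 ht.2)
  have h3 := mul_nonneg (Real.sqrt_nonneg t) (Real.sqrt_nonneg (1 - t))
  nlinarith [Real.sqrt_nonneg t, Real.sqrt_nonneg (1 - t)]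

lemma integrableOn_rpow_Ioo {r : ℝ} (hr : -1 < r) :
    IntegrableOn (fun t : ℝ ↦ t ^ r) (Ioo 0 1) :=
  ((intervalIntegrable_iff_integrableOn_Ioc_of_le zero_le_one).1
    (intervalIntegral.intervalIntegrable_rpow' hr)).mono_set Ioo_subset_Ioc_self

lemma integrableOn_one_sub_rpow_Ioo {r : ℝ} (hr : -1 < r) :
    IntegrableOn (fun t : ℝ ↦ (1 - t) ^ r) (Ioo 0 1) := by
  have h := (intervalIntegral.intervalIntegrable_rpow' (a := 1) (b := 0) hr).comp_sub_left 1
  simp only [sub_self, sub_zero] at h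
  exact ((intervalIntegrable_iff_integrableOn_Ioc_of_le zero_le_one).1 h).mono_set
    Ioo_subset_Ioc_self

lemma abs_integral_Ioo_le_of_le_div_of_le_rpow {g : ℝ → ℝ} {A B α η : ℝ} (hα : 0 < α)
    (hg : IntegrableOn g (Ioo 0 1)) (hA : ∀ t ∈ Ioo (0 : ℝ) 1, |g t| ≤ A / (1 - t))
    (hB : ∀ t ∈ Ioo (0 : ℝ) 1, |g t| ≤ B * (1 - t) ^ (α / 2 - 1)) (hη : 0 < η) (hη1 : η ≤ 1) :
    |∫ t in Ioo (0 : ℝ) 1, g t| ≤ -(A * Real.log η) + B * (2 / α * η ^ (α / 2)) := by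
  have hne : ∀ᵐ t : ℝ, t ≠ 1 := compl_mem_ae_iff.2 (measure_singleton 1)
  have hgI : IntervalIntegrable g volume 0 1 :=
    (intervalIntegrable_iff_integrableOn_Ioo_of_le zero_le_one).2 hg
  have hmem : 1 - η ∈ Icc (0 : ℝ) 1 := ⟨by linarith, by linarith⟩
  have hg1 : IntervalIntegrable g volume 0 (1 - η) :=
    hgI.mono_set (by rw [uIcc_of_le zero_le_one, uIcc_of_le hmem.1]; exact Icc_subset_Icc_right hmem.2)
  have hg2 : IntervalIntegrable g volume (1 - η) 1 :=
    hgI.mono_set (by rw [uIcc_of_le zero_le_one, uIcc_of_le hmem.2]; exact Icc_subset_Icc_left hmem.1)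
  rw [← integral_Ioc_eq_integral_Ioo, ← intervalIntegral.integral_of_le zero_le_one,
    ← intervalIntegral.integral_add_adjacent_intervals hg1 hg2]
  refine (abs_add_le _ _).trans (add_le_add ?_ ?_)
  · have hmem' : ∀ t ∈ Ioc 0 (1 - η), t ∈ Ioo (0 : ℝ) 1 := fun t ht ↦ ⟨ht.1, by linarith [ht.2]⟩
    have hbd : IntervalIntegrable (fun t ↦ A / (1 - t)) volume 0 (1 - η) := by
      refine ContinuousOn.intervalIntegrable ?_
      rw [uIcc_of_le hmem.1]
      exact continuousOn_const.div (by fun_prop) fun t ht ↦ by linarith [ht.2]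
    refine (intervalIntegral.norm_integral_le_of_norm_le (f := g) hmem.1
      (ae_of_all _ fun t ht ↦ hA t (hmem' t ht)) hbd).trans_eq ?_
    rw [intervalIntegral.integral_comp_sub_left (fun s ↦ A / s) 1]
    simp only [sub_sub_cancel, sub_zero, div_eq_mul_inv, intervalIntegral.integral_const_mul]
    rw [integral_inv_of_pos hη one_pos, one_div, Real.log_inv]
    ring
  · have hbd : IntervalIntegrable (fun t ↦ B * (1 - t) ^ (α / 2 - 1)) volume (1 - η) 1 := by
      have h := (intervalIntegral.intervalIntegrable_rpow' (a := η) (b := 0)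
        (r := α / 2 - 1) (by linarith)).comp_sub_left 1
      simp only [sub_zero] at h
      exact h.const_mul B
    refine (intervalIntegral.norm_integral_le_of_norm_le (f := g) hmem.2 (hne.mono fun t ht1 ht ↦
      hB t ⟨by linarith [ht.1], lt_of_le_of_ne ht.2 ht1⟩) hbd).trans_eq ?_
    rw [intervalIntegral.integral_comp_sub_left (fun s ↦ B * s ^ (α / 2 - 1)) 1]
    simp only [sub_sub_cancel, sub_self, intervalIntegral.integral_const_mul]
    rw [integral_rpow (.inl (by linarith)), sub_add_cancel, Real.zero_rpow (by positivity)]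
    field_simp
    simp

section HolderSmoothing

variable {E F : Type*} [NormedAddCommGroup E] [NormedAddCommGroup F] {h : E → ℝ} {α C : ℝ}

lemma continuous_of_abs_sub_le_rpow (hα : 0 < α) (hC : ∀ x y, |h x - h y| ≤ C * dist x y ^ α) :
    Continuous h := by
  refine continuous_iff_continuousAt.2 fun x ↦ tendsto_iff_dist_tendsto_zero.2 ?_
  refine squeeze_zero (fun _ ↦ dist_nonneg) (fun y ↦ hC y x) ?_
  have : Continuous fun y ↦ C * dist y x ^ α :=
    continuous_const.mul ((continuous_id.dist continuous_const).rpow_const fun _ ↦ .inr hα.le)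
  simpa [hα.ne'] using this.tendsto x

lemma rpow_le_one_add {r : ℝ} (hr : 0 ≤ r) (hα : α ∈ Ioc (0 : ℝ) 1) : r ^ α ≤ 1 + r :=
  calc r ^ α ≤ (1 + r) ^ α := Real.rpow_le_rpow hr (by linarith) hα.1.le
    _ ≤ (1 + r) ^ (1 : ℝ) := Real.rpow_le_rpow_of_exponent_le (by linarith) hα.2
    _ = 1 + r := Real.rpow_one _

lemma abs_le_mul_one_add_norm (hα : α ∈ Ioc (0 : ℝ) 1) (hC0 : 0 ≤ C)
    (hC : ∀ x y, |h x - h y| ≤ C * dist x y ^ α) (w : E) :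
    |h w| ≤ (|h 0| + C) * (1 + ‖w‖) := by
  have h1 : |h w| ≤ |h w - h 0| + |h 0| := by simpa using abs_add_le (h w - h 0) (h 0)
  have h2 := hC w 0
  rw [dist_zero_right] at h2
  have h3 := mul_le_mul_of_nonneg_left (rpow_le_one_add (norm_nonneg w) hα) hC0
  nlinarith [mul_nonneg (abs_nonneg (h 0)) (norm_nonneg w)]

variable [InnerProductSpace ℝ E] [FiniteDimensional ℝ E] [MeasurableSpace E] [BorelSpace E]
  {q : E → F} {M : ℝ}

lemma integrable_stdGaussian_of_norm_le {f : E → F} (hf : Continuous f)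
    (hM : ∀ z, ‖f z‖ ≤ M * (1 + ‖z‖) ^ 3) : Integrable f (ProbabilityTheory.stdGaussian E) := by
  have h : ∀ n : ℕ, Integrable (fun z : E ↦ ‖z‖ ^ n) (ProbabilityTheory.stdGaussian E) := fun n ↦ by
    simpa using integrable_norm_rpow_stdGaussian (E := E) n.cast_nonneg
  have h3 : Integrable (fun z : E ↦ M * (1 + ‖z‖) ^ 3) (ProbabilityTheory.stdGaussian E) := by
    refine ((((h 0).add ((h 1).const_mul 3)).add ((h 2).const_mul 3)).add (h 3)).const_mul M
      |>.congr (ae_of_all _ fun z ↦ ?_)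
    simp only [Pi.add_apply, pow_zero, pow_one]
    ring
  exact h3.mono' hf.aestronglyMeasurable (ae_of_all _ hM)

lemma integrable_norm_rpow_mul_norm (hα : α ∈ Icc (0 : ℝ) 1) (hq : Continuous q)
    (hM : ∀ z, ‖q z‖ ≤ M * (1 + ‖z‖) ^ 2) :
    Integrable (fun z ↦ ‖z‖ ^ α * ‖q z‖) (ProbabilityTheory.stdGaussian E) := by
  refine integrable_stdGaussian_of_norm_le (M := M)
    ((continuous_norm.rpow_const fun _ ↦ .inr hα.1).mul hq.norm) fun z ↦ ?_
  have h1 : ‖z‖ ^ α ≤ 1 + ‖z‖ := by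
    rcases hα.1.eq_or_lt with rfl | h0
    · simp
    · exact rpow_le_one_add (norm_nonneg z) ⟨h0, hα.2⟩
  rw [Real.norm_of_nonneg (by positivity)]
  calc _ ≤ (1 + ‖z‖) * (M * (1 + ‖z‖) ^ 2) :=
        mul_le_mul h1 (hM z) (norm_nonneg _) (by positivity)
    _ = _ := by ring

variable [NormedSpace ℝ F]

/-- The Gaussian average of `q` weighted by `h` along the interpolation
`√t x + √(1 - t) z`. -/
noncomputable def gaussianInterp (h : E → ℝ) (q : E → F) (t : ℝ) (x : E) : F :=
  ∫ z, h (√t • x + √(1 - t) • z) • q z ∂(ProbabilityTheory.stdGaussian E)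

lemma integrable_smul_stdGaussian (hα : α ∈ Ioc (0 : ℝ) 1) (hC0 : 0 ≤ C)
    (hC : ∀ x y, |h x - h y| ≤ C * dist x y ^ α) (hq : Continuous q)
    (hM : ∀ z, ‖q z‖ ≤ M * (1 + ‖z‖) ^ 2) (a : E) (s : ℝ) :
    Integrable (fun z ↦ h (a + s • z) • q z) (ProbabilityTheory.stdGaussian E) := by
  have hc := continuous_of_abs_sub_le_rpow hα.1 hC
  refine integrable_stdGaussian_of_norm_le (M := (|h 0| + C) * (1 + ‖a‖ + |s|) * M)
    (by fun_prop) fun z ↦ ?_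
  have h1 : 1 + ‖a + s • z‖ ≤ (1 + ‖a‖ + |s|) * (1 + ‖z‖) := by
    have := norm_add_le a (s • z)
    rw [norm_smul, Real.norm_eq_abs] at this
    nlinarith [norm_nonneg a, norm_nonneg z, mul_nonneg (norm_nonneg a) (norm_nonneg z),
      abs_nonneg s]
  rw [norm_smul, Real.norm_eq_abs]
  calc _ ≤ ((|h 0| + C) * ((1 + ‖a‖ + |s|) * (1 + ‖z‖))) * (M * (1 + ‖z‖) ^ 2) := by
        refine mul_le_mul ((abs_le_mul_one_add_norm hα hC0 hC _).trans ?_) (hM z) (norm_nonneg _)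
          (by positivity)
        gcongr
    _ = _ := by ring

lemma norm_gaussianInterp_le (hα : α ∈ Ioc (0 : ℝ) 1) (hC0 : 0 ≤ C)
    (hC : ∀ x y, |h x - h y| ≤ C * dist x y ^ α) (hq : Continuous q)
    (hM : ∀ z, ‖q z‖ ≤ M * (1 + ‖z‖) ^ 2)
    (hq0 : ∫ z, q z ∂(ProbabilityTheory.stdGaussian E) = 0) {t : ℝ} (ht : t ≤ 1) (x : E) :
    ‖gaussianInterp h q t x‖ ≤
      C * (1 - t) ^ (α / 2) * ∫ z, ‖z‖ ^ α * ‖q z‖ ∂(ProbabilityTheory.stdGaussian E) := by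
  have hcenter : gaussianInterp h q t x = ∫ z, (h (√t • x + √(1 - t) • z) - h (√t • x)) • q z
      ∂(ProbabilityTheory.stdGaussian E) := by
    simp_rw [sub_smul]
    have hi := integrable_smul_stdGaussian hα hC0 hC hq hM (√t • x) 0
    simp only [zero_smul, add_zero] at hi
    rw [integral_sub (integrable_smul_stdGaussian hα hC0 hC hq hM _ _) hi, integral_smul, hq0,
      smul_zero, sub_zero, gaussianInterp]
  rw [hcenter, ← integral_const_mul]
  refine norm_integral_le_of_norm_le ((integrable_norm_rpow_mul_norm ⟨hα.1.le, hα.2⟩ hq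
    hM).const_mul _) (ae_of_all _ fun z ↦ ?_)
  rw [norm_smul, Real.norm_eq_abs, ← mul_assoc]
  refine mul_le_mul_of_nonneg_right ((hC _ _).trans_eq ?_) (norm_nonneg _)
  rw [dist_eq_norm, add_sub_cancel_left, norm_smul, Real.norm_of_nonneg (Real.sqrt_nonneg _),
    Real.mul_rpow (Real.sqrt_nonneg _) (norm_nonneg _), Real.sqrt_eq_rpow,
    ← Real.rpow_mul (by linarith)]
  ring_nf

lemma norm_gaussianInterp_sub_le (hα : α ∈ Ioc (0 : ℝ) 1) (hC0 : 0 ≤ C)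
    (hC : ∀ x y, |h x - h y| ≤ C * dist x y ^ α) (hq : Continuous q)
    (hM : ∀ z, ‖q z‖ ≤ M * (1 + ‖z‖) ^ 2) {t : ℝ} (ht : t ≤ 1) (x y : E) :
    ‖gaussianInterp h q t x - gaussianInterp h q t y‖ ≤
      C * dist x y ^ α * ∫ z, ‖q z‖ ∂(ProbabilityTheory.stdGaussian E) := by
  have hqi : Integrable (fun z ↦ ‖q z‖) (ProbabilityTheory.stdGaussian E) := by
    simpa using integrable_norm_rpow_mul_norm (α := 0) (by simp) hq hM
  rw [gaussianInterp, gaussianInterp, ← integral_sub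
    (integrable_smul_stdGaussian hα hC0 hC hq hM _ _)
    (integrable_smul_stdGaussian hα hC0 hC hq hM _ _), ← integral_const_mul]
  refine norm_integral_le_of_norm_le (hqi.const_mul _) (ae_of_all _ fun z ↦ ?_)
  rw [← sub_smul, norm_smul, Real.norm_eq_abs]
  refine mul_le_mul_of_nonneg_right ((hC _ _).trans ?_) (norm_nonneg _)
  have h1 : dist (√t • x + √(1 - t) • z) (√t • y + √(1 - t) • z) ≤ dist x y := by
    rw [dist_add_right, dist_smul₀, Real.norm_of_nonneg (Real.sqrt_nonneg _)]
    exact mul_le_of_le_one_left dist_nonneg (Real.sqrt_le_one.2 ht)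
  exact mul_le_mul_of_nonneg_left (Real.rpow_le_rpow dist_nonneg h1 hα.1.le) hC0

lemma stronglyMeasurable_gaussianInterp (hh : Continuous h) (hq : Continuous q) (x : E) :
    StronglyMeasurable fun t ↦ gaussianInterp h q t x := by
  refine StronglyMeasurable.integral_prod_right (Continuous.stronglyMeasurable ?_)
  unfold Function.uncurry
  fun_prop

end HolderSmoothing

section BarbourSolution

variable {E : Type*} [NormedAddCommGroup E] [InnerProductSpace ℝ E]

/-- The second-order Hermite kernel `⟪z, v⟫ z - v`. -/
def hermiteKernel (v z : E) : E := ⟪z, v⟫ • z - v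

lemma continuous_hermiteKernel (v : E) : Continuous (hermiteKernel v) := by
  unfold hermiteKernel
  fun_prop

lemma norm_hermiteKernel_le (v z : E) : ‖hermiteKernel v z‖ ≤ ‖v‖ * (1 + ‖z‖) ^ 2 := by
  refine (norm_sub_le _ _).trans ?_
  rw [norm_smul, Real.norm_eq_abs]
  nlinarith [mul_le_mul_of_nonneg_right (abs_real_inner_le_norm z v) (norm_nonneg z),
    mul_nonneg (norm_nonneg v) (norm_nonneg z)]

variable [FiniteDimensional ℝ E] [MeasurableSpace E] [BorelSpace E]

lemma integral_hermiteKernel (v : E) :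
    ∫ z, hermiteKernel v z ∂(ProbabilityTheory.stdGaussian E) = 0 := by
  have h := hasFDerivAt_integral_inner_mul_comp_add_stdGaussian (k := fun _ : E ↦ (1 : ℝ)) (A := 1)
    continuous_const (fun w ↦ by simp) v 0
  simp only [one_smul] at h
  have h2 := h.unique (hasFDerivAt_const _ _)
  rw [← norm_eq_zero, ← innerSL_apply_norm (𝕜 := ℝ)]
  unfold hermiteKernel
  rw [h2, norm_zero]

/-- Barbour's solution of the Stein equation, on a finite-dimensional inner product space. -/
noncomputable def barbourSol (h : E → ℝ) (x : E) : ℝ :=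
  -∫ t in Ioo (0 : ℝ) 1, 1 / (2 * t) * ∫ z, (h (√t • x + √(1 - t) • z) -
    ∫ w, h w ∂(ProbabilityTheory.stdGaussian E)) ∂(ProbabilityTheory.stdGaussian E)

/-- The gradient of `barbourSol h`. -/
noncomputable def barbourGrad (h : E → ℝ) (x : E) : E :=
  -∫ t in Ioo (0 : ℝ) 1, (1 / (2 * t) * (√t / √(1 - t))) • gaussianInterp h id t x

/-- The Hessian of `barbourSol h` at `x`, applied to `v`. -/
noncomputable def barbourHess (h : E → ℝ) (x v : E) : E :=
  -∫ t in Ioo (0 : ℝ) 1, (1 / (2 * (1 - t))) • gaussianInterp h (hermiteKernel v) t x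

variable {h : E → ℝ} {α C : ℝ}

lemma norm_smul_gaussianInterp_id_le (hα : α ∈ Ioc (0 : ℝ) 1) (hC0 : 0 ≤ C)
    (hC : ∀ x y, |h x - h y| ≤ C * dist x y ^ α) {t : ℝ} (ht : t ∈ Ioo (0 : ℝ) 1) (x : E) :
    ‖(1 / (2 * t) * (√t / √(1 - t))) • gaussianInterp h id t x‖ ≤
      (C * ∫ z : E, ‖z‖ ^ α * ‖id z‖ ∂(ProbabilityTheory.stdGaussian E)) *
        (t ^ (-(1 / 2) : ℝ) + (1 - t) ^ (-(1 / 2) : ℝ)) := by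
  have ht1 : 0 < 1 - t := sub_pos.2 ht.2
  have hs : 0 < √t := Real.sqrt_pos.2 ht.1
  have hs1 : 0 < √(1 - t) := Real.sqrt_pos.2 ht1
  have h1 := norm_gaussianInterp_le hα hC0 hC continuous_id (M := 1)
    (fun z ↦ by rw [id]; nlinarith [norm_nonneg z]) integral_id_stdGaussian ht.2.le x
  have h2 : (1 - t) ^ (α / 2) ≤ 1 :=
    Real.rpow_le_one ht1.le (by linarith [ht.1]) (by linarith [hα.1])
  have h3 : 1 / (2 * t) * (√t / √(1 - t)) ≤ t ^ (-(1 / 2) : ℝ) + (1 - t) ^ (-(1 / 2) : ℝ) := by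
    rw [Real.rpow_neg ht.1.le, Real.rpow_neg ht1.le, ← Real.sqrt_eq_rpow, ← Real.sqrt_eq_rpow]
    have h4 := one_le_sqrt_add_sqrt_one_sub ⟨ht.1.le, ht.2.le⟩
    have h5 : 1 / (2 * t) * (√t / √(1 - t)) = (1 / 2) / (√t * √(1 - t)) := by
      have := Real.sq_sqrt ht.1.le
      field_simp
      rw [this, div_self ht.1.ne']
    rw [h5, inv_add_inv hs.ne' hs1.ne']
    gcongr
    linarith
  rw [norm_smul, Real.norm_of_nonneg (by have := ht.1; positivity), mul_comm]
  refine mul_le_mul (h1.trans ?_) h3 (by have := ht.1; positivity) ?_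
  · refine mul_le_mul_of_nonneg_right (mul_le_of_le_one_right hC0 h2) ?_
    exact integral_nonneg fun z ↦ by positivity
  · exact mul_nonneg hC0 (integral_nonneg fun z ↦ by positivity)

lemma norm_smul_gaussianInterp_le {F : Type*} [NormedAddCommGroup F] [NormedSpace ℝ F] {q : E → F}
    {M : ℝ} (hα : α ∈ Ioc (0 : ℝ) 1) (hC0 : 0 ≤ C)
    (hC : ∀ x y, |h x - h y| ≤ C * dist x y ^ α) (hq : Continuous q)
    (hM : ∀ z, ‖q z‖ ≤ M * (1 + ‖z‖) ^ 2)
    (hq0 : ∫ z, q z ∂(ProbabilityTheory.stdGaussian E) = 0)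
    {t : ℝ} (ht : t < 1) (x : E) :
    ‖(1 / (2 * (1 - t))) • gaussianInterp h q t x‖ ≤
      (C * (∫ z : E, ‖z‖ ^ α * ‖q z‖ ∂(ProbabilityTheory.stdGaussian E)) / 2) *
        (1 - t) ^ (α / 2 - 1) := by
  have ht1 : 0 < 1 - t := sub_pos.2 ht
  rw [norm_smul, Real.norm_of_nonneg (by positivity), Real.rpow_sub_one ht1.ne']
  refine (mul_le_mul_of_nonneg_left (norm_gaussianInterp_le hα hC0 hC hq hM hq0 ht.le x)
    (by positivity)).trans_eq ?_
  field_simp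

lemma integrable_smul_gaussianInterp {F : Type*} [NormedAddCommGroup F] [NormedSpace ℝ F]
    {q : E → F} {M : ℝ} (hα : α ∈ Ioc (0 : ℝ) 1) (hC0 : 0 ≤ C)
    (hC : ∀ x y, |h x - h y| ≤ C * dist x y ^ α) (hq : Continuous q)
    (hM : ∀ z, ‖q z‖ ≤ M * (1 + ‖z‖) ^ 2)
    (hq0 : ∫ z, q z ∂(ProbabilityTheory.stdGaussian E) = 0) (x : E) :
    IntegrableOn (fun t ↦ (1 / (2 * (1 - t))) • gaussianInterp h q t x) (Ioo 0 1) := by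
  have hc := continuous_of_abs_sub_le_rpow hα.1 hC
  refine Integrable.mono' ((integrableOn_one_sub_rpow_Ioo (r := α / 2 - 1)
    (by linarith [hα.1])).const_mul _) ?_ (ae_restrict_of_forall_mem measurableSet_Ioo fun t ht ↦
      norm_smul_gaussianInterp_le hα hC0 hC hq hM hq0 ht.2 x)
  refine StronglyMeasurable.aestronglyMeasurable ?_
  exact (Measurable.stronglyMeasurable (by fun_prop)).smul
    (stronglyMeasurable_gaussianInterp hc hq x)

lemma aestronglyMeasurable_smul_gaussianInterp_id (hh : Continuous h) (x : E) :
    AEStronglyMeasurable (fun t ↦ (1 / (2 * t) * (√t / √(1 - t))) • gaussianInterp h id t x)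
      (volume.restrict (Ioo 0 1)) :=
  ((Measurable.stronglyMeasurable (by fun_prop)).smul
    (stronglyMeasurable_gaussianInterp hh continuous_id x)).aestronglyMeasurable

lemma integrableOn_rpow_add_one_sub_rpow :
    IntegrableOn (fun t : ℝ ↦ t ^ (-(1 / 2) : ℝ) + (1 - t) ^ (-(1 / 2) : ℝ)) (Ioo 0 1) :=
  (integrableOn_rpow_Ioo (by norm_num)).add (integrableOn_one_sub_rpow_Ioo (by norm_num))

lemma integrable_smul_gaussianInterp_id (hα : α ∈ Ioc (0 : ℝ) 1) (hC0 : 0 ≤ C)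
    (hC : ∀ x y, |h x - h y| ≤ C * dist x y ^ α) (x : E) :
    IntegrableOn (fun t ↦ (1 / (2 * t) * (√t / √(1 - t))) • gaussianInterp h id t x) (Ioo 0 1) :=
  Integrable.mono' (integrableOn_rpow_add_one_sub_rpow.const_mul _)
    (aestronglyMeasurable_smul_gaussianInterp_id (continuous_of_abs_sub_le_rpow hα.1 hC) x)
    (ae_restrict_of_forall_mem measurableSet_Ioo fun _ ht ↦
      norm_smul_gaussianInterp_id_le hα hC0 hC ht x)

lemma aestronglyMeasurable_mul_integral_sub (hh : Continuous h) (m : ℝ) (x : E) :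
    AEStronglyMeasurable (fun t ↦ 1 / (2 * t) * ∫ z, (h (√t • x + √(1 - t) • z) - m)
      ∂(ProbabilityTheory.stdGaussian E)) (volume.restrict (Ioo 0 1)) := by
  refine StronglyMeasurable.aestronglyMeasurable ?_
  refine (Measurable.stronglyMeasurable (by fun_prop)).mul ?_
  refine StronglyMeasurable.integral_prod_right (Continuous.stronglyMeasurable ?_)
  unfold Function.uncurry
  fun_prop

lemma integrable_comp_add_smul_stdGaussian (hα : α ∈ Ioc (0 : ℝ) 1) (hC0 : 0 ≤ C)
    (hC : ∀ x y, |h x - h y| ≤ C * dist x y ^ α) (a : E) (s : ℝ) :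
    Integrable (fun z ↦ h (a + s • z)) (ProbabilityTheory.stdGaussian E) := by
  simpa using integrable_smul_stdGaussian hα hC0 hC (q := fun _ : E ↦ (1 : ℝ)) (M := 1)
    continuous_const (fun z ↦ by
      rw [norm_one, one_mul]; exact one_le_pow₀ (by linarith [norm_nonneg z])) a s

lemma integrable_barbourSol_integrand (hα : α ∈ Ioc (0 : ℝ) 1) (hC0 : 0 ≤ C)
    (hC : ∀ x y, |h x - h y| ≤ C * dist x y ^ α) (x : E) :
    IntegrableOn (fun t ↦ 1 / (2 * t) * ∫ z, (h (√t • x + √(1 - t) • z) -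
      ∫ w, h w ∂(ProbabilityTheory.stdGaussian E)) ∂(ProbabilityTheory.stdGaussian E))
      (Ioo 0 1) := by
  refine Integrable.mono' ((integrableOn_rpow_Ioo (r := α / 2 - 1)
    (by linarith [hα.1])).const_mul
      (C / 2 * ∫ z : E, (1 + ‖x‖ + ‖z‖) ∂(ProbabilityTheory.stdGaussian E)))
    (aestronglyMeasurable_mul_integral_sub (continuous_of_abs_sub_le_rpow hα.1 hC) _ x)
    (ae_restrict_of_forall_mem measurableSet_Ioo fun t ht ↦ ?_)
  have ht0 := ht.1
  have hint := integrable_comp_add_smul_stdGaussian hα hC0 hC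
  have hint0 := hint 0 1
  simp only [zero_add, one_smul] at hint0
  have h1 : ∫ z, (h (√t • x + √(1 - t) • z) - ∫ w, h w ∂(ProbabilityTheory.stdGaussian E))
      ∂(ProbabilityTheory.stdGaussian E) = ∫ z, (h (√t • x + √(1 - t) • z) - h z)
      ∂(ProbabilityTheory.stdGaussian E) := by
    rw [integral_sub (hint _ _) (integrable_const _), integral_sub (hint _ _) hint0]
    simp
  have h2 : ‖∫ z, (h (√t • x + √(1 - t) • z) - h z) ∂(ProbabilityTheory.stdGaussian E)‖ ≤
      ∫ z : E, C * t ^ (α / 2) * (1 + ‖x‖ + ‖z‖) ∂(ProbabilityTheory.stdGaussian E) := by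
    refine norm_integral_le_of_norm_le (Integrable.const_mul ?_ _) (ae_of_all _ fun z ↦ ?_)
    · exact (integrable_const _).add (IsGaussian.integrable_id.norm)
    have h3 : dist (√t • x + √(1 - t) • z) z ≤ √t * (‖x‖ + ‖z‖) := by
      have h4 : √t • x + √(1 - t) • z - z = √t • x - (1 - √(1 - t)) • z := by module
      have h5 : √(1 - t) ≤ 1 := Real.sqrt_le_one.2 (by linarith)
      rw [dist_eq_norm, h4]
      refine (norm_sub_le _ _).trans ?_
      rw [norm_smul, norm_smul, Real.norm_of_nonneg (Real.sqrt_nonneg _),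
        Real.norm_of_nonneg (sub_nonneg.2 h5), mul_add]
      gcongr
      linarith [one_le_sqrt_add_sqrt_one_sub ⟨ht.1.le, ht.2.le⟩]
    calc _ ≤ C * (√t * (‖x‖ + ‖z‖)) ^ α := (hC _ _).trans <|
          mul_le_mul_of_nonneg_left (Real.rpow_le_rpow dist_nonneg h3 hα.1.le) hC0
      _ = C * t ^ (α / 2) * (‖x‖ + ‖z‖) ^ α := by
          rw [Real.mul_rpow (by positivity) (by positivity), Real.sqrt_eq_rpow,
            ← Real.rpow_mul ht0.le]
          ring_nf
      _ ≤ C * t ^ (α / 2) * (1 + ‖x‖ + ‖z‖) := by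
          rw [add_assoc]
          gcongr
          exact rpow_le_one_add (by positivity) hα
  rw [integral_const_mul] at h2
  rw [h1, norm_mul, Real.norm_of_nonneg (by positivity), Real.rpow_sub_one ht0.ne']
  refine (mul_le_mul_of_nonneg_left h2 (by positivity)).trans_eq ?_
  field_simp

theorem hasFDerivAt_barbourSol (hα : α ∈ Ioc (0 : ℝ) 1) (hC0 : 0 ≤ C)
    (hC : ∀ x y, |h x - h y| ≤ C * dist x y ^ α) (x : E) :
    HasFDerivAt (barbourSol h) (innerSL ℝ (barbourGrad h x)) x := by
  have hh := continuous_of_abs_sub_le_rpow hα.1 hC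
  unfold barbourSol
  rw [barbourGrad, map_neg, ← (innerSL ℝ).integral_comp_comm
    (integrable_smul_gaussianInterp_id hα hC0 hC x)]
  refine HasFDerivAt.neg ?_
  refine hasFDerivAt_integral_of_dominated_of_fderiv_le
    (bound := fun t ↦ (C * ∫ z : E, ‖z‖ ^ α * ‖id z‖ ∂(ProbabilityTheory.stdGaussian E)) *
      (t ^ (-(1 / 2) : ℝ) + (1 - t) ^ (-(1 / 2) : ℝ)))
    (F' := fun x t ↦ innerSL ℝ ((1 / (2 * t) * (√t / √(1 - t))) • gaussianInterp h id t x))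
    univ_mem (Eventually.of_forall fun x ↦ aestronglyMeasurable_mul_integral_sub hh _ x)
    (integrable_barbourSol_integrand hα hC0 hC x)
    ((innerSL ℝ).continuous.comp_aestronglyMeasurable
      (aestronglyMeasurable_smul_gaussianInterp_id hh x))
    (ae_restrict_of_forall_mem measurableSet_Ioo fun t ht x _ ↦ ?_)
    (integrableOn_rpow_add_one_sub_rpow.const_mul _)
    (ae_restrict_of_forall_mem measurableSet_Ioo fun t ht x _ ↦ ?_)
  · rw [innerSL_apply_norm]
    exact norm_smul_gaussianInterp_id_le hα hC0 hC ht x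
  · have h1 := ((hasFDerivAt_integral_smul_add_smul_stdGaussian hh
      (abs_le_mul_one_add_norm hα hC0 hC) ht x).sub_const
        (∫ w, h w ∂(ProbabilityTheory.stdGaussian E))).const_mul (1 / (2 * t))
    simp_rw [integral_sub (integrable_comp_add_smul_stdGaussian hα hC0 hC _ _)
      (integrable_const _), integral_const, probReal_univ, one_smul]
    refine h1.congr_fderiv ?_
    rw [← map_smul, smul_smul]
    rfl

theorem hasFDerivAt_inner_barbourGrad (hα : α ∈ Ioc (0 : ℝ) 1) (hC0 : 0 ≤ C)
    (hC : ∀ x y, |h x - h y| ≤ C * dist x y ^ α) (v x : E) :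
    HasFDerivAt (fun x ↦ ⟪barbourGrad h x, v⟫) (innerSL ℝ (barbourHess h x v)) x := by
  have hh := continuous_of_abs_sub_le_rpow hα.1 hC
  have hint := integrable_smul_gaussianInterp hα hC0 hC (continuous_hermiteKernel v)
    (norm_hermiteKernel_le v) (integral_hermiteKernel v) x
  have hinner : ∀ x, ⟪barbourGrad h x, v⟫ = -∫ t in Ioo (0 : ℝ) 1,
      ⟪v, (1 / (2 * t) * (√t / √(1 - t))) • gaussianInterp h id t x⟫ := fun x ↦ by
    rw [integral_inner (integrable_smul_gaussianInterp_id hα hC0 hC x), barbourGrad,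
      inner_neg_left, real_inner_comm]
  simp_rw [hinner]
  rw [barbourHess, map_neg, ← (innerSL ℝ).integral_comp_comm hint]
  refine HasFDerivAt.neg ?_
  refine hasFDerivAt_integral_of_dominated_of_fderiv_le
    (bound := fun t ↦ (C * (∫ z : E, ‖z‖ ^ α * ‖hermiteKernel v z‖
      ∂(ProbabilityTheory.stdGaussian E)) / 2) * (1 - t) ^ (α / 2 - 1))
    (F' := fun x t ↦ innerSL ℝ ((1 / (2 * (1 - t))) • gaussianInterp h (hermiteKernel v) t x))
    univ_mem (Eventually.of_forall fun x ↦ ?_)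
    ((integrable_smul_gaussianInterp_id hα hC0 hC x).const_inner v)
    ((innerSL ℝ).continuous.comp_aestronglyMeasurable hint.aestronglyMeasurable)
    (ae_restrict_of_forall_mem measurableSet_Ioo fun t ht x _ ↦ ?_)
    ((integrableOn_one_sub_rpow_Ioo (r := α / 2 - 1) (by linarith [hα.1])).const_mul _)
    (ae_restrict_of_forall_mem measurableSet_Ioo fun t ht x _ ↦ ?_)
  · exact aestronglyMeasurable_const.inner (aestronglyMeasurable_smul_gaussianInterp_id hh x)
  · rw [innerSL_apply_norm]
    exact norm_smul_gaussianInterp_le hα hC0 hC (continuous_hermiteKernel v)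
      (norm_hermiteKernel_le v) (integral_hermiteKernel v) ht.2 x
  · have h1 := (hasFDerivAt_integral_inner_mul_smul_add_smul_stdGaussian hh
      (abs_le_mul_one_add_norm hα hC0 hC) ht v x).const_mul (1 / (2 * t) * (√t / √(1 - t)))
    have h2 : ∀ x, ⟪v, (1 / (2 * t) * (√t / √(1 - t))) • gaussianInterp h id t x⟫ =
        1 / (2 * t) * (√t / √(1 - t)) * ∫ z, ⟪z, v⟫ * h (√t • x + √(1 - t) • z)
          ∂(ProbabilityTheory.stdGaussian E) := fun x ↦ by
      rw [real_inner_smul_right, gaussianInterp, ← integral_inner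
        (integrable_smul_stdGaussian hα hC0 hC continuous_id (M := 1)
          (fun z ↦ by rw [id]; nlinarith [norm_nonneg z]) _ _)]
      simp_rw [real_inner_smul_right, id, real_inner_comm v, mul_comm (h _)]
    simp_rw [h2]
    refine h1.congr_fderiv ?_
    have h3 : 1 / (2 * t) * (√t / √(1 - t)) * (√t / √(1 - t)) = 1 / (2 * (1 - t)) := by
      have ht0 := ht.1
      have ht1 : 0 < 1 - t := sub_pos.2 ht.2
      have hs1 : 0 < √(1 - t) := Real.sqrt_pos.2 ht1
      rw [mul_assoc, div_mul_div_comm, Real.mul_self_sqrt ht0.le, Real.mul_self_sqrt ht1.le]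
      field_simp
    rw [← map_smul, smul_smul, h3]
    rfl

end BarbourSolution

section HessianRegularity

variable {E : Type*} [NormedAddCommGroup E] [InnerProductSpace ℝ E]

lemma norm_inner_hermiteKernel_le (u v z : E) :
    ‖⟪u, hermiteKernel v z⟫‖ ≤ ‖u‖ * ‖v‖ * (1 + ‖z‖) ^ 2 := by
  rw [mul_assoc]
  exact (norm_inner_le_norm _ _).trans
    (mul_le_mul_of_nonneg_left (norm_hermiteKernel_le v z) (norm_nonneg u))

variable [FiniteDimensional ℝ E] [MeasurableSpace E] [BorelSpace E]

lemma integral_norm_rpow_mul_norm_inner_hermiteKernel_le [Nontrivial E] {p : ℝ}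
    (hp : p ∈ Icc (0 : ℝ) 1) {u v : E} (hu : ‖u‖ = 1) (hv : ‖v‖ = 1) :
    ∫ z, ‖z‖ ^ p * ‖⟪u, hermiteKernel v z⟫‖ ∂(ProbabilityTheory.stdGaussian E) ≤
      (2 + p / finrank ℝ E) * ∫ z : E, ‖z‖ ^ p ∂(ProbabilityTheory.stdGaussian E) := by
  have hn : 0 < (finrank ℝ E : ℝ) := by exact_mod_cast finrank_pos
  have hint : ∀ w : E, ‖w‖ = 1 →
      Integrable (fun z ↦ ‖z‖ ^ p * ⟪z, w⟫ ^ 2) (ProbabilityTheory.stdGaussian E) := fun w hw ↦ by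
    have h := integrable_norm_rpow_mul_norm (E := E) (q := fun z ↦ ⟪z, w⟫ ^ 2) (M := 1) hp
      (by fun_prop) fun z ↦ by
        have h1 := abs_real_inner_le_norm z w
        rw [hw, mul_one] at h1
        rw [norm_pow, one_mul]
        exact pow_le_pow_left₀ (norm_nonneg _) (h1.trans (by linarith)) 2
    simpa using h
  have hadd : Integrable (fun z ↦ ‖z‖ ^ p * ⟪z, u⟫ ^ 2 + ‖z‖ ^ p * ⟪z, v⟫ ^ 2)
      (ProbabilityTheory.stdGaussian E) := (hint u hu).add (hint v hv)
  have hbound : ∀ z, ‖⟪u, hermiteKernel v z⟫‖ ≤ (⟪z, u⟫ ^ 2 + ⟪z, v⟫ ^ 2) / 2 + 1 := fun z ↦ by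
    have h1 := abs_real_inner_le_norm u v
    rw [hu, hv, mul_one] at h1
    rw [hermiteKernel, inner_sub_right, real_inner_smul_right, real_inner_comm z u,
      Real.norm_eq_abs, abs_le]
    rw [abs_le] at h1
    constructor <;> nlinarith [sq_nonneg (⟪z, u⟫ - ⟪z, v⟫), sq_nonneg (⟪z, u⟫ + ⟪z, v⟫)]
  calc _ ≤ ∫ z, ((‖z‖ ^ p * ⟪z, u⟫ ^ 2 + ‖z‖ ^ p * ⟪z, v⟫ ^ 2) / 2 + ‖z‖ ^ p)
          ∂(ProbabilityTheory.stdGaussian E) := by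
        refine integral_mono (integrable_norm_rpow_mul_norm hp ?_ (norm_inner_hermiteKernel_le u v))
          ((hadd.div_const 2).add
            (integrable_norm_rpow_stdGaussian hp.1)) fun z ↦ ?_
        · exact continuous_const.inner (continuous_hermiteKernel v)
        · refine (mul_le_mul_of_nonneg_left (hbound z) (by positivity)).trans_eq ?_
          ring
    _ = _ := by
        rw [integral_add (hadd.div_const 2)
          (integrable_norm_rpow_stdGaussian hp.1), integral_div,
          integral_add (hint u hu) (hint v hv),
          integral_norm_rpow_mul_inner_sq_stdGaussian hp.1 hu,
          integral_norm_rpow_mul_inner_sq_stdGaussian hp.1 hv]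
        field_simp
        ring

variable {h : E → ℝ} {α C : ℝ}

lemma inner_gaussianInterp_hermiteKernel (hα : α ∈ Ioc (0 : ℝ) 1) (hC0 : 0 ≤ C)
    (hC : ∀ x y, |h x - h y| ≤ C * dist x y ^ α) (u v : E) (t : ℝ) (x : E) :
    ⟪u, gaussianInterp h (hermiteKernel v) t x⟫ =
      gaussianInterp h (fun z ↦ ⟪u, hermiteKernel v z⟫) t x := by
  rw [gaussianInterp, gaussianInterp, ← integral_inner (integrable_smul_stdGaussian hα hC0 hC
    (continuous_hermiteKernel v) (norm_hermiteKernel_le v) _ _)]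
  simp_rw [real_inner_smul_right, smul_eq_mul]

lemma integral_inner_hermiteKernel (u v : E) :
    ∫ z, ⟪u, hermiteKernel v z⟫ ∂(ProbabilityTheory.stdGaussian E) = 0 := by
  rw [integral_inner, integral_hermiteKernel, inner_zero_right]
  refine integrable_stdGaussian_of_norm_le (M := ‖v‖) (continuous_hermiteKernel v) fun z ↦
    (norm_hermiteKernel_le v z).trans (mul_le_mul_of_nonneg_left ?_ (norm_nonneg v))
  exact pow_le_pow_right₀ (by linarith [norm_nonneg z]) (by norm_num)

lemma abs_inner_barbourHess_sub_le [Nontrivial E] (hα : α ∈ Ioc (0 : ℝ) 1) (hC0 : 0 ≤ C)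
    (hC : ∀ x y, |h x - h y| ≤ C * dist x y ^ α) {u v : E} (hu : ‖u‖ = 1) (hv : ‖v‖ = 1) (x y : E)
    {η : ℝ} (hη : 0 < η) (hη1 : η ≤ 1) :
    |⟪u, barbourHess h x v - barbourHess h y v⟫| ≤ -(C * dist x y ^ α * Real.log η) +
      C * ((2 + α / finrank ℝ E) * ∫ z : E, ‖z‖ ^ α ∂(ProbabilityTheory.stdGaussian E)) *
        (2 / α * η ^ (α / 2)) := by
  have hα' : α ∈ Icc (0 : ℝ) 1 := ⟨hα.1.le, hα.2⟩
  set q : E → ℝ := fun z ↦ ⟪u, hermiteKernel v z⟫ with hqdef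
  have hq : Continuous q := continuous_const.inner (continuous_hermiteKernel v)
  have hM : ∀ z, ‖q z‖ ≤ ‖u‖ * ‖v‖ * (1 + ‖z‖) ^ 2 := norm_inner_hermiteKernel_le u v
  have hq0 : ∫ z, q z ∂(ProbabilityTheory.stdGaussian E) = 0 := integral_inner_hermiteKernel u v
  have hint := integrable_smul_gaussianInterp hα hC0 hC hq hM hq0
  have hinner : ∀ x, ⟪u, barbourHess h x v⟫ =
      -∫ t in Ioo (0 : ℝ) 1, (1 / (2 * (1 - t))) • gaussianInterp h q t x := fun x ↦ by
    rw [barbourHess, inner_neg_right, ← integral_inner (integrable_smul_gaussianInterp hα hC0 hC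
      (continuous_hermiteKernel v) (norm_hermiteKernel_le v) (integral_hermiteKernel v) x)]
    simp_rw [real_inner_smul_right, inner_gaussianInterp_hermiteKernel hα hC0 hC, smul_eq_mul,
      hqdef]
  rw [inner_sub_right, hinner, hinner, ← neg_sub_neg, neg_neg, neg_neg,
    ← integral_sub (hint y) (hint x)]
  refine abs_integral_Ioo_le_of_le_div_of_le_rpow hα.1 ((hint y).sub (hint x))
    (fun t ht ↦ ?_) (fun t ht ↦ ?_) hη hη1
  · have ht1 : 0 < 1 - t := sub_pos.2 ht.2
    have h0 : ∫ z, ‖q z‖ ∂(ProbabilityTheory.stdGaussian E) ≤ 2 := by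
      simpa using integral_norm_rpow_mul_norm_inner_hermiteKernel_le (p := 0) (by simp) hu hv
    have h1 := norm_gaussianInterp_sub_le hα hC0 hC hq hM ht.2.le y x
    rw [← smul_sub, ← Real.norm_eq_abs, norm_smul, Real.norm_of_nonneg (by positivity),
      dist_comm x y]
    calc _ ≤ 1 / (2 * (1 - t)) * (C * dist y x ^ α * 2) := by
          refine mul_le_mul_of_nonneg_left (h1.trans ?_) (by positivity)
          exact mul_le_mul_of_nonneg_left h0 (by positivity)
      _ = _ := by field_simp
  · have ht1 : 0 < 1 - t := sub_pos.2 ht.2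
    have h0 := integral_norm_rpow_mul_norm_inner_hermiteKernel_le hα' hu hv
    have h1 := fun x ↦ norm_smul_gaussianInterp_le hα hC0 hC hq hM hq0 ht.2 x
    calc _ ≤ C * (∫ z : E, ‖z‖ ^ α * ‖q z‖ ∂(ProbabilityTheory.stdGaussian E)) *
          (1 - t) ^ (α / 2 - 1) := by
          refine (norm_sub_le _ _).trans ((add_le_add (h1 y) (h1 x)).trans_eq ?_)
          ring
      _ ≤ _ := by gcongr

lemma norm_barbourHess_sub_le [Nontrivial E] (hα : α ∈ Ioc (0 : ℝ) 1) (hC0 : 0 ≤ C)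
    (hC : ∀ x y, |h x - h y| ≤ C * dist x y ^ α) {v : E} (hv : ‖v‖ = 1) (x y : E)
    {η : ℝ} (hη : 0 < η) (hη1 : η ≤ 1) :
    ‖barbourHess h x v - barbourHess h y v‖ ≤ -(C * dist x y ^ α * Real.log η) +
      C * ((2 + α / finrank ℝ E) * ∫ z : E, ‖z‖ ^ α ∂(ProbabilityTheory.stdGaussian E)) *
        (2 / α * η ^ (α / 2)) := by
  have key := fun u (hu : ‖u‖ = 1) ↦ abs_inner_barbourHess_sub_le hα hC0 hC hu hv x y hη hη1
  set w := barbourHess h x v - barbourHess h y v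
  rcases eq_or_ne w 0 with hw | hw
  · rw [hw, norm_zero]
    exact (abs_nonneg _).trans (key v hv)
  · have hw' : ‖w‖ ≠ 0 := norm_ne_zero_iff.2 hw
    refine le_trans ?_ ((le_abs_self _).trans (key (‖w‖⁻¹ • w) ?_))
    · rw [real_inner_smul_left, real_inner_self_eq_norm_sq]
      exact le_of_eq (by field_simp)
    · rw [norm_smul, norm_inv, norm_norm, inv_mul_cancel₀ hw']

lemma barbourHess_sum (hα : α ∈ Ioc (0 : ℝ) 1) (hC0 : 0 ≤ C)
    (hC : ∀ x y, |h x - h y| ≤ C * dist x y ^ α) {ι : Type*} (s : Finset ι) (c : ι → ℝ)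
    (b : ι → E) (x : E) :
    barbourHess h x (∑ i ∈ s, c i • b i) = ∑ i ∈ s, c i • barbourHess h x (b i) := by
  have h1 := hasFDerivAt_inner_barbourGrad hα hC0 hC (∑ i ∈ s, c i • b i) x
  have h2 : HasFDerivAt (fun x ↦ ∑ i ∈ s, c i • ⟪barbourGrad h x, b i⟫)
      (∑ i ∈ s, c i • innerSL ℝ (barbourHess h x (b i))) x :=
    HasFDerivAt.fun_sum fun i _ ↦
      (hasFDerivAt_inner_barbourGrad hα hC0 hC (b i) x).const_smul (c i)
  simp_rw [inner_sum, real_inner_smul_right] at h1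
  have h3 := h1.unique h2
  refine ext_inner_right ℝ fun w ↦ ?_
  have h4 := DFunLike.congr_fun h3 w
  simpa [sum_inner, real_inner_smul_left] using h4

end HessianRegularity

lemma stdGaussian_eq (d : ℕ) :
    _root_.stdGaussian d = ProbabilityTheory.stdGaussian (EuclideanSpace ℝ (Fin d)) :=
  map_pi_eq_stdGaussian

lemma steinSol_eq_barbourSol (d : ℕ) (h : EuclideanSpace ℝ (Fin d) → ℝ) :
    steinSol d h = barbourSol h := by
  ext x
  simp only [steinSol, hbar, stdGaussian_eq, barbourSol]

section SteinSol

variable {d : ℕ} {h : EuclideanSpace ℝ (Fin d) → ℝ} {α C : ℝ}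

lemma hessEntry_steinSol (hα : α ∈ Ioc (0 : ℝ) 1) (hC0 : 0 ≤ C) (hC : HolderConst α C h)
    (x : EuclideanSpace ℝ (Fin d)) (i j : Fin d) :
    hessEntry (steinSol d h) x i j = barbourHess h x (EuclideanSpace.single j 1) i := by
  have h1 : pderivI j (steinSol d h) =
      fun x ↦ ⟪barbourGrad h x, EuclideanSpace.single j (1 : ℝ)⟫ := by
    ext x
    rw [pderivI, steinSol_eq_barbourSol, (hasFDerivAt_barbourSol hα hC0 hC x).fderiv,
      innerSL_apply_apply]
  rw [hessEntry, h1, pderivI, (hasFDerivAt_inner_barbourGrad hα hC0 hC _ x).fderiv,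
    innerSL_apply_apply, EuclideanSpace.inner_single_right]
  simp

lemma hessMatrix_steinSol_mulVec (hα : α ∈ Ioc (0 : ℝ) 1) (hC0 : 0 ≤ C) (hC : HolderConst α C h)
    (x v : EuclideanSpace ℝ (Fin d)) :
    (hessMatrix (steinSol d h) x).mulVec v = barbourHess h x v := by
  have hv : v = ∑ j, v j • EuclideanSpace.single j (1 : ℝ) := by
    simpa using ((EuclideanSpace.basisFun (Fin d) ℝ).sum_repr v).symm
  conv_rhs => rw [hv, barbourHess_sum hα hC0 hC]
  ext i
  simp [Matrix.mulVec, dotProduct, hessMatrix, hessEntry_steinSol hα hC0 hC, mul_comm]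

lemma matOpNorm_hessMatrix_sub_le (hα : α ∈ Ioc (0 : ℝ) 1) (hC0 : 0 ≤ C) (hC : HolderConst α C h)
    (x y : EuclideanSpace ℝ (Fin d)) {B : ℝ} (hB : 0 ≤ B)
    (hle : ∀ v, ‖v‖ = 1 → ‖barbourHess h x v - barbourHess h y v‖ ≤ B) :
    matOpNorm (hessMatrix (steinSol d h) x - hessMatrix (steinSol d h) y) ≤ B := by
  refine Real.sSup_le ?_ hB
  rintro _ ⟨v, hv, rfl⟩
  convert hle v hv
  rw [WithLp.equiv_apply, Matrix.sub_mulVec, hessMatrix_steinSol_mulVec hα hC0 hC,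
    hessMatrix_steinSol_mulVec hα hC0 hC]
  rfl

lemma norm_barbourHess_sub_le_C1 (hd : 1 ≤ d) (hα : α ∈ Ioc (0 : ℝ) 1) (hC0 : 0 ≤ C)
    (hC : HolderConst α C h) {v : EuclideanSpace ℝ (Fin d)} (hv : ‖v‖ = 1)
    (x y : EuclideanSpace ℝ (Fin d)) {η : ℝ} (hη : 0 < η) (hη1 : η ≤ 1) :
    ‖barbourHess h x v - barbourHess h y v‖ ≤
      C * (C1 α d * η ^ (α / 2) - dist x y ^ α * Real.log η) := by
  have hd0 : (0 : ℝ) < d := by exact_mod_cast hd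
  have : Nonempty (Fin d) := ⟨⟨0, hd⟩⟩
  have hα0 := hα.1
  refine (norm_barbourHess_sub_le hα hC0 hC hv x y hη hη1).trans_eq ?_
  have h1 : C1 α d = 2 / α * ((2 + α / d) *
      ∫ z : EuclideanSpace ℝ (Fin d), ‖z‖ ^ α ∂(ProbabilityTheory.stdGaussian _)) := by
    rw [integral_norm_rpow_stdGaussian hα0.le, finrank_euclideanSpace_fin, C1,
      Real.rpow_add_one two_ne_zero]
    have : Real.Gamma (d / 2) ≠ 0 := (Real.Gamma_pos_of_pos (by positivity)).ne'
    field_simp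
    ring
  rw [h1, finrank_euclideanSpace_fin]
  ring

end SteinSol

end

/-- **Proposition 2.2, display (2.9)**: log-Hölder regularity of the Hessian of Barbour's
solution, in operator norm. -/
theorem steinSol_hessian_log_regularity
    {d : ℕ} (hd : 1 ≤ d) {α : ℝ} (hα : α ∈ Set.Ioc (0 : ℝ) 1)
    (h : EuclideanSpace ℝ (Fin d) → ℝ)
    {C : ℝ} (hC0 : 0 ≤ C) (hC : HolderConst α C h) :
    ∀ x y : EuclideanSpace ℝ (Fin d),
      (dist x y ≤ 1 →
        matOpNorm (hessMatrix (steinSol d h) x - hessMatrix (steinSol d h) y) ≤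
          C * dist x y ^ α * (C1 α d - 2 * Real.log (dist x y))) ∧
      (1 < dist x y →
        matOpNorm (hessMatrix (steinSol d h) x - hessMatrix (steinSol d h) y) ≤
          C1 α d * C) := by
  have hd0 : (0 : ℝ) < d := by exact_mod_cast hd
  have hα0 := hα.1
  have hC1 : 0 ≤ C1 α d := by
    have h1 := (Real.Gamma_pos_of_pos (s := (α + d) / 2) (by positivity)).le
    have h2 := (Real.Gamma_pos_of_pos (s := (d : ℝ) / 2) (by positivity)).le
    unfold C1
    positivity
  intro x y
  refine ⟨fun hxy ↦ ?_, fun hxy ↦ ?_⟩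
  · rcases eq_or_ne x y with rfl | hne
    · rw [dist_self, Real.zero_rpow hα0.ne', mul_zero, zero_mul]
      exact matOpNorm_hessMatrix_sub_le hα hC0 hC x x le_rfl fun v _ ↦ by simp
    have hr := dist_pos.2 hne
    refine matOpNorm_hessMatrix_sub_le hα hC0 hC x y ?_ fun v hv ↦ ?_
    · have := Real.log_nonpos hr.le hxy
      exact mul_nonneg (by positivity) (by linarith)
    · refine (norm_barbourHess_sub_le_C1 hd hα hC0 hC hv x y (η := dist x y ^ 2) (by positivity)
        (pow_le_one₀ hr.le hxy)).trans_eq ?_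
      rw [Real.log_pow, ← Real.rpow_natCast, ← Real.rpow_mul hr.le, Nat.cast_ofNat,
        mul_div_cancel₀ α two_ne_zero]
      ring
  · refine matOpNorm_hessMatrix_sub_le hα hC0 hC x y (mul_nonneg hC1 hC0) fun v hv ↦ ?_
    refine (norm_barbourHess_sub_le_C1 hd hα hC0 hC hv x y one_pos le_rfl).trans_eq ?_
    rw [Real.log_one, Real.one_rpow]
    ring
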